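/- There exist ε₀ > 0 and C₀ > 0 such that: if f = (ζ;τ) : ℍ → ℍ is (1+ε)-biLipschitz with ε ≤ ε₀, f(O) = O, and for some R > 0 and some A ∈ O(2) with det A = +1 one has d(f(z;0), (Az; 0)) ≤ C₀ ε^{1/16} R for all z ∈ ℂ with |z| ≤ R, then τ(0,0,t)/t > 0 for all t ∈ ℝ with t ≠ 0. -/

import Mathlib

noncomputable section

open MeasureTheory

/-- Points of the Heisenberg group `ℍ`, identified with `ℝ³ ≅ ℂ × ℝ`:
`(x, y, t)` corresponds to `(z ; t)` with `z = x + iy`. -/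
abbrev H : Type := ℝ × ℝ × ℝ

/-- The Heisenberg group law
`(x,y,t)·(x',y',t') = (x+x', y+y', t+t'+2(x'y − xy'))`. -/
def Hmul (p q : H) : H :=
  (p.1 + q.1, p.2.1 + q.2.1, p.2.2 + q.2.2 + 2 * (q.1 * p.2.1 - p.1 * q.2.1))

/-- The Heisenberg group inverse. -/
def Hinv (p : H) : H := (-p.1, -p.2.1, -p.2.2)

/-- The identity `O = (0,0,0)`. -/
def HO : H := (0, 0, 0)

/-- The control (Carnot–Carathéodory) distance: the infimum of the lengths
`∫₀¹ √(a(s)² + b(s)²) ds` of horizontal Lipschitz curves `γ` joining `P` to `Q`,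
i.e. curves satisfying a.e. `γ' = a·X(γ) + b·Y(γ)` where `X = ∂ₓ + 2y∂_t` and
`Y = ∂_y − 2x∂_t`. -/
def dH (P Q : H) : ℝ :=
  sInf { L : ℝ | ∃ (γ : ℝ → H) (a b : ℝ → ℝ) (K : NNReal),
    LipschitzWith K γ ∧ γ 0 = P ∧ γ 1 = Q ∧
    (∀ᵐ s ∂volume, s ∈ Set.Icc (0:ℝ) 1 →
      HasDerivAt γ (a s, b s, 2 * (γ s).2.1 * a s - 2 * (γ s).1 * b s) s) ∧
    IntervalIntegrable (fun s => Real.sqrt (a s ^ 2 + b s ^ 2)) volume 0 1 ∧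
    L = ∫ s in (0:ℝ)..1, Real.sqrt (a s ^ 2 + b s ^ 2) }

/-- `γ : ℝ → ℍ` is a `(1+ε)`-quasigeodesic. -/
def IsQuasiGeodesic (ε : ℝ) (γ : ℝ → H) : Prop :=
  ∀ s s' : ℝ, (1 + ε)⁻¹ * |s - s'| ≤ dH (γ s) (γ s') ∧
    dH (γ s) (γ s') ≤ (1 + ε) * |s - s'|

/-- `f : ℍ → ℍ` is `(1+ε)`-biLipschitz for the control distance. -/
def IsBiLip (ε : ℝ) (f : H → H) : Prop :=
  ∀ P Q : H, (1 + ε)⁻¹ * dH P Q ≤ dH (f P) (f Q) ∧ dH (f P) (f Q) ≤ (1 + ε) * dH P Q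

/-- `(a,b)` is the horizontal speed of `γ`: a.e. `γ'(s) = a(s)X(γ(s)) + b(s)Y(γ(s))`. -/
def HasHorizSpeed (γ : ℝ → H) (a b : ℝ → ℝ) : Prop :=
  ∀ᵐ s ∂volume, HasDerivAt γ (a s, b s, 2 * (γ s).2.1 * a s - 2 * (γ s).1 * b s) s


/-- speed -/
def vv (a b : ℝ → ℝ) (s : ℝ) : ℝ := Real.sqrt (a s ^ 2 + b s ^ 2)

/-- horizontal on an interval -/
def Hor (γ : ℝ → H) (a b : ℝ → ℝ) (α β : ℝ) : Prop :=
  (∃ K : NNReal, LipschitzWith K γ) ∧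
  (∀ᵐ s ∂volume, s ∈ Set.Icc α β →
      HasDerivAt γ (a s, b s, 2 * (γ s).2.1 * a s - 2 * (γ s).1 * b s) s) ∧
  IntervalIntegrable (vv a b) volume α β

def IsHC (P Q : H) (L : ℝ) : Prop :=
  ∃ (γ : ℝ → H) (a b : ℝ → ℝ), Hor γ a b 0 1 ∧ γ 0 = P ∧ γ 1 = Q ∧
    L = ∫ s in (0:ℝ)..1, vv a b s

lemma dH_eq (P Q : H) : dH P Q = sInf {L | IsHC P Q L} := by
  unfold dH
  congr 1
  ext L
  constructor
  · rintro ⟨γ, a, b, K, h1, h2, h3, h4, h5, h6⟩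
    exact ⟨γ, a, b, ⟨⟨K, h1⟩, h4, h5⟩, h2, h3, h6⟩
  · rintro ⟨γ, a, b, ⟨⟨K, h1⟩, h4, h5⟩, h2, h3, h6⟩
    exact ⟨γ, a, b, K, h1, h2, h3, h4, h5, h6⟩

lemma vv_nonneg (a b : ℝ → ℝ) (s : ℝ) : 0 ≤ vv a b s := Real.sqrt_nonneg _

lemma IsHC.nonneg {P Q : H} {L : ℝ} (h : IsHC P Q L) : 0 ≤ L := by
  obtain ⟨γ, a, b, -, -, -, rfl⟩ := h
  exact intervalIntegral.integral_nonneg (by norm_num) (fun s _ => vv_nonneg a b s)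

lemma IsHC.dH_le {P Q : H} {L : ℝ} (h : IsHC P Q L) : dH P Q ≤ L := by
  rw [dH_eq]
  exact csInf_le ⟨0, fun x hx => IsHC.nonneg hx⟩ h

lemma ae_affine {p : ℝ → Prop} (h : ∀ᵐ s, p s) (c d : ℝ) (hc : c ≠ 0) : ∀ᵐ s, p (c * s + d) := by
  have h1 : ∀ᵐ s, p (s + d) := (measurePreserving_add_right volume d).quasiMeasurePreserving.ae h
  rw [ae_iff] at h1 ⊢
  have : {s | ¬ p (c * s + d)} = (fun x => c * x) ⁻¹' {s | ¬ p (s + d)} := rfl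
  rw [this, Real.volume_preimage_mul_left hc, h1, mul_zero]

lemma Hor.reparam {γ : ℝ → H} {a b : ℝ → ℝ} {α β : ℝ} (h : Hor γ a b α β) (c d α' β' : ℝ)
    (hc : 0 < c) (h1 : c * α' + d = α) (h2 : c * β' + d = β) :
    Hor (fun s => γ (c * s + d)) (fun s => c * a (c * s + d)) (fun s => c * b (c * s + d)) α' β' ∧
    ∫ s in α'..β', vv (fun s => c * a (c * s + d)) (fun s => c * b (c * s + d)) s
      = ∫ s in α..β, vv a b s := by
  obtain ⟨⟨K, hK⟩, hd, hi⟩ := h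
  have hv : vv (fun s => c * a (c * s + d)) (fun s => c * b (c * s + d))
      = fun s => c * vv a b (c * s + d) := by
    funext s
    unfold vv
    rw [show (c * a (c * s + d))^2 + (c * b (c * s + d))^2
      = c^2 * (a (c * s + d)^2 + b (c * s + d)^2) by ring, Real.sqrt_mul (by positivity),
      Real.sqrt_sq hc.le]
  refine ⟨⟨?_, ?_, ?_⟩, ?_⟩
  · have hl : LipschitzWith (Real.toNNReal c) (fun s : ℝ => c * s + d) := by
      apply LipschitzWith.of_dist_le_mul
      intro x y
      rw [Real.dist_eq, Real.dist_eq, Real.coe_toNNReal _ hc.le,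
        show c * x + d - (c * y + d) = c * (x - y) by ring, abs_mul, abs_of_pos hc]
    exact ⟨_, hK.comp hl⟩
  · filter_upwards [ae_affine hd c d hc.ne'] with s hs hs'
    have hs2 : c * s + d ∈ Set.Icc α β := by
      subst h1 h2
      constructor <;> nlinarith [hs'.1, hs'.2]
    have h3 : HasDerivAt (fun s : ℝ => c * s + d) c s := by
      simpa using ((hasDerivAt_id s).const_mul c).add_const d
    have h4 := (hs hs2).scomp s h3
    refine HasDerivAt.congr_deriv h4 ?_
    ext
    · simp
    · simp
    · simp; ring
  · rw [hv]
    apply IntervalIntegrable.const_mul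
    have h5 := (hi.comp_add_right d).comp_mul_left (c := c)
    convert h5 using 1
    · rw [← h1]; field_simp; ring
    · rw [← h2]; field_simp; ring
  · rw [hv, intervalIntegral.integral_const_mul,
      intervalIntegral.integral_comp_mul_add (vv a b) hc.ne', h1, h2, smul_eq_mul]
    field_simp

lemma Hor.isHC {γ : ℝ → H} {a b : ℝ → ℝ} {α β : ℝ} (h : Hor γ a b α β) (hab : α < β) :
    IsHC (γ α) (γ β) (∫ s in α..β, vv a b s) := by
  obtain ⟨h1, h2⟩ := h.reparam (β - α) α 0 1 (by linarith) (by ring) (by ring)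
  exact ⟨_, _, _, h1, by simp, by simp, h2.symm⟩

lemma Hor.mono {γ : ℝ → H} {a b : ℝ → ℝ} {α β α' β' : ℝ} (h : Hor γ a b α β) (h1 : α ≤ α')
    (h2 : α' ≤ β') (h3 : β' ≤ β) : Hor γ a b α' β' := by
  refine ⟨h.1, ?_, ?_⟩
  · filter_upwards [h.2.1] with s hs hs'
    exact hs ⟨h1.trans hs'.1, hs'.2.trans h3⟩
  · apply h.2.2.mono_set
    rw [Set.uIcc_of_le h2, Set.uIcc_of_le (by linarith)]
    exact Set.Icc_subset_Icc h1 h3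

lemma IsHC.trans {P Q S : H} {L L' : ℝ} (h : IsHC P Q L) (h' : IsHC Q S L') :
    IsHC P S (L + L') := by
  obtain ⟨γ₁, a₁, b₁, g1, rfl, rfl, rfl⟩ := h
  obtain ⟨γ₂, a₂, b₂, g2, e0, rfl, rfl⟩ := h'
  obtain ⟨g3, e3⟩ := g2.reparam 1 (-1) 1 2 (by norm_num) (by norm_num) (by norm_num)
  rw [← e3]
  clear e3
  simp only [one_mul] at g3 ⊢
  set γ₃ : ℝ → H := fun s => γ₂ (s + -1) with hγ₃
  set a₃ : ℝ → ℝ := fun s => a₂ (s + -1)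
  set b₃ : ℝ → ℝ := fun s => b₂ (s + -1)
  have e1 : γ₃ 1 = γ₁ 1 := by simp [hγ₃, e0]
  have e2 : γ₂ 1 = γ₃ 2 := by simp only [hγ₃]; norm_num
  rw [e2]
  clear_value γ₃ a₃ b₃
  obtain ⟨⟨K1, l1⟩, d1, i1⟩ := g1
  obtain ⟨⟨K3, l3⟩, d3, i3⟩ := g3
  let γ : ℝ → H := fun s => γ₁ (min s 1) + γ₃ (max s 1) - γ₁ 1
  let a : ℝ → ℝ := fun s => if s < 1 then a₁ s else a₃ s
  let b : ℝ → ℝ := fun s => if s < 1 then b₁ s else b₃ s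
  have v1 : ∀ᵐ s, s ∈ Set.uIoc (0:ℝ) 1 → vv a₁ b₁ s = vv a b s := by
    have : ∀ᵐ s : ℝ, s ≠ 1 := by simp [ae_iff]
    filter_upwards [this] with s hs hs'
    rw [Set.uIoc_of_le (by norm_num)] at hs'
    have : s < 1 := lt_of_le_of_ne hs'.2 hs
    simp [vv, a, b, this]
  have v3 : ∀ s, s ∈ Set.uIoc (1:ℝ) 2 → vv a₃ b₃ s = vv a b s := by
    intro s hs'
    rw [Set.uIoc_of_le (by norm_num)] at hs'
    have : ¬ s < 1 := not_lt.2 hs'.1.le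
    simp [vv, a, b, this]
  have i1' : IntervalIntegrable (vv a b) volume 0 1 :=
    i1.congr_ae (by
      rw [Filter.EventuallyEq, ae_restrict_iff' measurableSet_uIoc]; exact v1)
  have i3' : IntervalIntegrable (vv a b) volume 1 2 :=
    i3.congr (fun s hs => v3 s hs)
  have hor : Hor γ a b 0 2 := by
    refine ⟨?_, ?_, i1'.trans i3'⟩
    · refine ⟨K1 * 1 + K3 * 1 + 0, ?_⟩
      have := ((l1.comp (LipschitzWith.id.min_const (1:ℝ))).add
        (l3.comp (LipschitzWith.id.max_const (1:ℝ)))).sub (LipschitzWith.const (γ₁ 1))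
      exact this
    · have : ∀ᵐ s : ℝ, s ≠ 1 := by simp [ae_iff]
      filter_upwards [this, d1, d3] with s hs h1 h3 hs'
      rcases lt_or_gt_of_ne hs with h | h
      · have ev : ∀ x, x < 1 → γ x = γ₁ x := by
          intro x hx
          simp only [γ]
          rw [min_eq_left hx.le, max_eq_right hx.le, e1]; abel
        have := h1 ⟨hs'.1, h.le⟩
        rw [ev s h]
        simp only [a, b, h, if_true]
        apply this.congr_of_eventuallyEq
        filter_upwards [Iio_mem_nhds h] with x hx
        exact ev x hx
      · have ev : ∀ x, 1 < x → γ x = γ₃ x := by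
          intro x hx
          simp only [γ]
          rw [min_eq_right hx.le, max_eq_left hx.le]; abel
        have := h3 ⟨h.le, hs'.2⟩
        rw [ev s h]
        simp only [a, b, not_lt.2 h.le, if_false]
        apply this.congr_of_eventuallyEq
        filter_upwards [Ioi_mem_nhds h] with x hx
        exact ev x hx
  have := hor.isHC (by norm_num)
  rw [← intervalIntegral.integral_add_adjacent_intervals i1' i3',
    ← intervalIntegral.integral_congr_ae v1, ← intervalIntegral.integral_congr_ae
      (Filter.Eventually.of_forall v3)] at this
  have z0 : γ 0 = γ₁ 0 := by simp [γ, e1]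
  have z2 : γ 2 = γ₃ 2 := by simp [γ]
  rw [z0, z2] at this
  exact this

/-- translate and dilate -/
def Phi (l : ℝ) (p : H) (q : H) : H := Hmul p (l * q.1, l * q.2.1, l ^ 2 * q.2.2)

lemma IsHC.map {P Q : H} {L : ℝ} (h : IsHC P Q L) (l : ℝ) (p : H) :
    IsHC (Phi l p P) (Phi l p Q) (|l| * L) := by
  obtain ⟨γ, a, b, ⟨⟨K, hK⟩, hd, hi⟩, rfl, rfl, rfl⟩ := h
  let T : H →ₗ[ℝ] H :=
    { toFun := fun q => (l * q.1, l * q.2.1, l ^ 2 * q.2.2 + 2 * (l * q.1 * p.2.1 - p.1 * (l * q.2.1)))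
      map_add' := by
        intro x y
        ext <;> simp <;> ring
      map_smul' := by
        intro c x
        ext <;> simp <;> ring }
  have hT : ∀ q, Phi l p q = LinearMap.toContinuousLinearMap T q + p := by
    intro q
    ext <;> simp [T, Phi, Hmul] <;> ring
  have hv : vv (fun s => l * a s) (fun s => l * b s) = fun s => |l| * vv a b s := by
    funext s
    unfold vv
    rw [show (l * a s)^2 + (l * b s)^2 = l^2 * (a s^2 + b s^2) by ring,
      Real.sqrt_mul (by positivity), Real.sqrt_sq_eq_abs]
  refine ⟨fun s => Phi l p (γ s), fun s => l * a s, fun s => l * b s, ⟨?_, ?_, ?_⟩, rfl, rfl, ?_⟩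
  · simp_rw [hT]
    exact ⟨_, ((LinearMap.toContinuousLinearMap T).lipschitz.comp hK).add (LipschitzWith.const p)⟩
  · filter_upwards [hd] with s hs hs'
    have := ((LinearMap.toContinuousLinearMap T).hasFDerivAt.comp_hasDerivAt s (hs hs')).add_const p
    simp_rw [hT]
    refine HasDerivAt.congr_deriv this ?_
    ext
    · simp [T]
    · simp [T]
    · simp [T]; ring
  · rw [hv]; exact hi.const_mul _
  · rw [hv, intervalIntegral.integral_const_mul]

lemma IsHC.seg (x y : ℝ) : IsHC HO (x, y, 0) (Real.sqrt (x ^ 2 + y ^ 2)) := by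
  refine ⟨fun s => s • ((x, y, 0) : H), fun _ => x, fun _ => y, ⟨?_, ?_, ?_⟩, ?_, ?_, ?_⟩
  · exact ⟨_, ((ContinuousLinearMap.id ℝ ℝ).smulRight ((x, y, 0) : H)).lipschitz⟩
  · refine Filter.Eventually.of_forall fun s _ => ?_
    have := (hasDerivAt_id s).smul_const ((x, y, 0) : H)
    refine HasDerivAt.congr_deriv this ?_
    ext
    · simp
    · simp
    · simp; ring
  · exact intervalIntegrable_const
  · ext <;> simp [HO]
  · simp
  · simp [vv]

lemma IsHC.left {P Q : H} {L : ℝ} (h : IsHC P Q L) (p : H) :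
    IsHC (Hmul p P) (Hmul p Q) L := by
  have := h.map 1 p
  simpa [Phi] using this

lemma IsHC.step (p : H) (x y : ℝ) : IsHC p (Hmul p (x, y, 0)) (Real.sqrt (x ^ 2 + y ^ 2)) := by
  have := (IsHC.seg x y).left p
  have e : Hmul p HO = p := by ext <;> simp [Hmul, HO]
  rwa [e] at this

lemma IsHC.loop (p : H) (x y : ℝ) : IsHC p (Hmul p (0, 0, -4 * x * y)) (2 * |x| + 2 * |y|) := by
  have h1 := IsHC.step p x 0
  have h2 := IsHC.step (Hmul p (x, 0, 0)) 0 y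
  have h3 := IsHC.step (Hmul (Hmul p (x, 0, 0)) (0, y, 0)) (-x) 0
  have h4 := IsHC.step (Hmul (Hmul (Hmul p (x, 0, 0)) (0, y, 0)) (-x, 0, 0)) 0 (-y)
  have h := ((h1.trans h2).trans h3).trans h4
  convert h using 1
  · ext <;> simp [Hmul]; ring
  · simp [Real.sqrt_sq_eq_abs]; ring

lemma IsHC.vert (p : H) (s : ℝ) : IsHC p (Hmul p (0, 0, s)) (2 * Real.sqrt |s|) := by
  have hs := Real.mul_self_sqrt (abs_nonneg s)
  have hn := Real.sqrt_nonneg |s|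
  rcases le_total 0 s with h | h
  · have := IsHC.loop p (Real.sqrt |s| / 2) (-(Real.sqrt |s| / 2))
    convert this using 1
    · congr 3
      rw [abs_of_nonneg h] at hs ⊢
      linarith
    · rw [abs_neg, abs_of_nonneg (a := Real.sqrt |s| / 2) (by positivity)]; ring
  · have := IsHC.loop p (Real.sqrt |s| / 2) (Real.sqrt |s| / 2)
    convert this using 1
    · congr 3
      rw [abs_of_nonpos h] at hs ⊢
      linarith
    · rw [abs_of_nonneg (a := Real.sqrt |s| / 2) (by positivity)]; ring

lemma IsHC.gen (p : H) (x y s : ℝ) :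
    IsHC p (Hmul p (x, y, s)) (Real.sqrt (x ^ 2 + y ^ 2) + 2 * Real.sqrt |s|) := by
  have := (IsHC.step p x y).trans (IsHC.vert _ s)
  convert this using 1
  ext <;> simp [Hmul]; ring

lemma Hmul_inv_cancel (P Q : H) : Hmul P (Hmul (Hinv P) Q) = Q := by
  ext <;> simp [Hmul, Hinv]; ring

lemma Hinv_mul_cancel (P Q : H) : Hmul (Hinv P) (Hmul P Q) = Q := by
  ext <;> simp [Hmul, Hinv]; ring

lemma Hinv_mul (P : H) : Hmul (Hinv P) P = HO := by
  ext <;> simp [Hmul, Hinv, HO, mul_comm]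

lemma Hmul_assoc (P Q S : H) : Hmul (Hmul P Q) S = Hmul P (Hmul Q S) := by
  ext <;> simp [Hmul] <;> ring

lemma exists_HC (P Q : H) : ∃ L, IsHC P Q L := by
  have := IsHC.gen P (Hmul (Hinv P) Q).1 (Hmul (Hinv P) Q).2.1 (Hmul (Hinv P) Q).2.2
  rw [show ((Hmul (Hinv P) Q).1, (Hmul (Hinv P) Q).2.1, (Hmul (Hinv P) Q).2.2)
    = Hmul (Hinv P) Q from rfl, Hmul_inv_cancel] at this
  exact ⟨_, this⟩

lemma dH_lt {P Q : H} {L : ℝ} (h : dH P Q < L) : ∃ L' < L, IsHC P Q L' := by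
  rw [dH_eq] at h
  obtain ⟨L', h1, h2⟩ := exists_lt_of_csInf_lt (exists_HC P Q) h
  exact ⟨L', h2, h1⟩

lemma dH_nonneg (P Q : H) : 0 ≤ dH P Q := by
  rw [dH_eq]
  exact le_csInf (exists_HC P Q) (fun L h => IsHC.nonneg h)

lemma dH_tri (P Q S : H) : dH P S ≤ dH P Q + dH Q S := by
  apply le_of_forall_pos_le_add
  intro e he
  obtain ⟨L1, h1, h2⟩ := dH_lt (P := P) (Q := Q) (L := dH P Q + e / 2) (by linarith)
  obtain ⟨L3, h3, h4⟩ := dH_lt (P := Q) (Q := S) (L := dH Q S + e / 2) (by linarith)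
  have := (h2.trans h4).dH_le
  linarith

lemma dH_map (P Q : H) (l : ℝ) (p : H) : dH (Phi l p P) (Phi l p Q) ≤ |l| * dH P Q := by
  apply le_of_forall_pos_le_add
  intro e he
  obtain ⟨L1, h1, h2⟩ := dH_lt (P := P) (Q := Q) (L := dH P Q + e / (|l| + 1))
    (by have : 0 < e / (|l| + 1) := by positivity
        linarith)
  have := (h2.map l p).dH_le
  have h5 : |l| * L1 ≤ |l| * (dH P Q + e / (|l| + 1)) := by gcongr
  have h6 : |l| * (e / (|l| + 1)) ≤ e := by
    rw [mul_div_assoc', div_le_iff₀ (by positivity)]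
    nlinarith [abs_nonneg l]
  linarith

lemma dH_left_le (p P Q : H) : dH (Hmul p P) (Hmul p Q) ≤ dH P Q := by
  have := dH_map P Q 1 p
  simpa [Phi] using this

lemma dH_left (p P Q : H) : dH (Hmul p P) (Hmul p Q) = dH P Q := by
  apply le_antisymm (dH_left_le p P Q)
  have := dH_left_le (Hinv p) (Hmul p P) (Hmul p Q)
  rwa [Hinv_mul_cancel, Hinv_mul_cancel] at this

lemma dH_O (P Q : H) : dH P Q = dH HO (Hmul (Hinv P) Q) := by
  rw [← dH_left (Hinv P) P Q, Hinv_mul]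

lemma dH_up (P : H) : dH HO P ≤ Real.sqrt (P.1 ^ 2 + P.2.1 ^ 2) + 2 * Real.sqrt |P.2.2| := by
  have := (IsHC.gen HO P.1 P.2.1 P.2.2).dH_le
  rwa [show Hmul HO (P.1, P.2.1, P.2.2) = P by ext <;> simp [Hmul, HO]] at this

lemma mvt {G v : ℝ → ℝ} {α β C : ℝ} (hab : α ≤ β) (hG : AbsolutelyContinuousOnInterval G α β)
    (hv : IntervalIntegrable v volume α β)
    (hd : ∀ᵐ s, s ∈ Set.Icc α β → ∃ g', HasDerivAt G g' s ∧ |g'| ≤ C * v s) :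
    |G β - G α| ≤ C * ∫ s in α..β, v s := by
  rw [← hG.integral_deriv_eq_sub, ← intervalIntegral.integral_const_mul]
  have := intervalIntegral.norm_integral_le_of_norm_le (μ := volume) (f := deriv G)
    (g := fun s => C * v s) hab ?_ (hv.const_mul C)
  · exact this
  · filter_upwards [hd] with s hs hs'
    obtain ⟨g', h1, h2⟩ := hs ⟨hs'.1.le, hs'.2⟩
    rw [h1.deriv]
    exact h2

lemma Hor.derivs {γ : ℝ → H} {a b : ℝ → ℝ} {α β : ℝ} (h : Hor γ a b α β) :
    AbsolutelyContinuousOnInterval (fun s => (γ s).1) α β ∧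
    AbsolutelyContinuousOnInterval (fun s => (γ s).2.1) α β ∧
    AbsolutelyContinuousOnInterval (fun s => (γ s).2.2) α β ∧
    ∀ᵐ s, s ∈ Set.Icc α β → HasDerivAt (fun s => (γ s).1) (a s) s ∧
      HasDerivAt (fun s => (γ s).2.1) (b s) s ∧
      HasDerivAt (fun s => (γ s).2.2) (2 * (γ s).2.1 * a s - 2 * (γ s).1 * b s) s := by
  obtain ⟨⟨K, hK⟩, hd, hi⟩ := h
  refine ⟨?_, ?_, ?_, ?_⟩
  · exact ((LipschitzWith.prod_fst.comp hK).lipschitzOnWith).absolutelyContinuousOnInterval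
  · exact (((LipschitzWith.prod_fst.comp LipschitzWith.prod_snd).comp hK).lipschitzOnWith).absolutelyContinuousOnInterval
  · exact (((LipschitzWith.prod_snd.comp LipschitzWith.prod_snd).comp hK).lipschitzOnWith).absolutelyContinuousOnInterval
  · filter_upwards [hd] with s hs hs'
    have h0 := hs hs'
    have h1 : HasDerivAt (fun s => (γ s).2) (b s, 2 * (γ s).2.1 * a s - 2 * (γ s).1 * b s) s :=
      (ContinuousLinearMap.snd ℝ ℝ (ℝ × ℝ)).hasFDerivAt.comp_hasDerivAt s h0
    exact ⟨(ContinuousLinearMap.fst ℝ ℝ (ℝ × ℝ)).hasFDerivAt.comp_hasDerivAt s h0,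
      (ContinuousLinearMap.fst ℝ ℝ ℝ).hasFDerivAt.comp_hasDerivAt s h1,
      (ContinuousLinearMap.snd ℝ ℝ ℝ).hasFDerivAt.comp_hasDerivAt s h1⟩

lemma cs (c1 c2 a b : ℝ) : |c1 * a + c2 * b| ≤ Real.sqrt (c1 ^ 2 + c2 ^ 2) * Real.sqrt (a ^ 2 + b ^ 2) := by
  rw [← Real.sqrt_mul (by positivity)]
  apply Real.abs_le_sqrt
  nlinarith [sq_nonneg (c1 * b - c2 * a)]

lemma Hor.proj {γ : ℝ → H} {a b : ℝ → ℝ} {α β : ℝ} (h : Hor γ a b α β) (hab : α ≤ β) :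
    Real.sqrt (((γ β).1 - (γ α).1) ^ 2 + ((γ β).2.1 - (γ α).2.1) ^ 2) ≤ ∫ s in α..β, vv a b s := by
  obtain ⟨hx, hy, ht, hd⟩ := h.derivs
  set c1 := (γ β).1 - (γ α).1
  set c2 := (γ β).2.1 - (γ α).2.1
  have hI : 0 ≤ ∫ s in α..β, vv a b s :=
    intervalIntegral.integral_nonneg hab (fun s _ => vv_nonneg a b s)
  have := mvt (C := Real.sqrt (c1 ^ 2 + c2 ^ 2)) hab ((hx.const_mul c1).add (hy.const_mul c2)) h.2.2 (by
    filter_upwards [hd] with s hs hs'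
    obtain ⟨h1, h2, h3⟩ := hs hs'
    exact ⟨_, (h1.const_mul c1).add (h2.const_mul c2), cs _ _ _ _⟩)
  simp only [Pi.add_apply] at this
  rw [show c1 * (γ β).1 + c2 * (γ β).2.1 - (c1 * (γ α).1 + c2 * (γ α).2.1) = c1 ^ 2 + c2 ^ 2 by
    simp only [c1, c2]; ring, abs_of_nonneg (by positivity)] at this
  rcases eq_or_lt_of_le (Real.sqrt_nonneg (c1 ^ 2 + c2 ^ 2)) with h0 | h0
  · rw [← h0]; exact hI
  · have h2 := Real.mul_self_sqrt (show 0 ≤ c1 ^ 2 + c2 ^ 2 by positivity)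
    nlinarith

lemma dev (u1 u2 x y l1 l2 L r B : ℝ) (hr : r = Real.sqrt (u1 ^ 2 + u2 ^ 2))
    (hr2 : r * r = u1 ^ 2 + u2 ^ 2) (h0 : 0 < r) (hB0 : 0 ≤ B) (hB2 : B * B = 2 * L * (L - r))
    (hL : 0 ≤ L) (hrL : r ≤ L) (e : l1 + l2 = L) (p1 : 0 ≤ l1) (p2 : 0 ≤ l2)
    (e1 : Real.sqrt (x ^ 2 + y ^ 2) ≤ l1)
    (e2 : Real.sqrt ((u1 - x) ^ 2 + (u2 - y) ^ 2) ≤ l2) : |u1 * y - u2 * x| ≤ r * B := by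
  apply abs_le_of_sq_le_sq _ (by positivity)
  have q1 := cs u1 u2 x y
  rw [← hr] at q1
  have q2 := cs u1 u2 (u1 - x) (u2 - y)
  rw [← hr] at q2
  have q3 := abs_le.1 (q1.trans (mul_le_mul_of_nonneg_left e1 h0.le))
  have q4 := (abs_le.1 (q2.trans (mul_le_mul_of_nonneg_left e2 h0.le))).2
  have q5 : x ^ 2 + y ^ 2 ≤ l1 ^ 2 := by
    rw [← Real.sqrt_le_sqrt_iff (by positivity), Real.sqrt_sq p1]; exact e1
  have q4' : r * r - (u1 * x + u2 * y) ≤ r * l2 := by rw [hr2]; linarith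
  have q6 : (u1 * y - u2 * x) ^ 2 = r * r * (x ^ 2 + y ^ 2) - (u1 * x + u2 * y) ^ 2 := by
    rw [hr2]; ring
  generalize u1 * x + u2 * y = q at *
  have q7 : r * r * (x ^ 2 + y ^ 2) ≤ r * r * l1 ^ 2 := by gcongr
  have q8 : r * l1 - q ≤ r * (L - r) := by rw [← e]; linarith
  have q9' : 0 ≤ r * l2 := by positivity
  have q9 : r * l1 + q ≤ 2 * r * L := by rw [← e]; linarith [q3.2]
  have q10 : (r * l1 - q) * (r * l1 + q) ≤ (r * (L - r)) * (2 * r * L) :=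
    mul_le_mul q8 q9 (by linarith [q3.1]) (mul_nonneg h0.le (by linarith))
  have q11 : (r * B) ^ 2 = r * r * (2 * L * (L - r)) := by rw [← hB2]; ring
  rw [q11, q6]
  linarith

set_option maxHeartbeats 800000 in
lemma IsHC.low {u1 u2 σ L : ℝ} (h : IsHC HO (u1, u2, σ) L) :
    Real.sqrt (u1 ^ 2 + u2 ^ 2) ≤ L ∧ σ ^ 2 ≤ 32 * L ^ 3 * (L - Real.sqrt (u1 ^ 2 + u2 ^ 2)) := by
  have hL := h.nonneg
  obtain ⟨γ, a, b, hor, g0, g1, hLe⟩ := h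
  have x0 : (γ 0).1 = 0 := by rw [g0]; rfl
  have y0 : (γ 0).2.1 = 0 := by rw [g0]; rfl
  have t0 : (γ 0).2.2 = 0 := by rw [g0]; rfl
  have x1 : (γ 1).1 = u1 := by rw [g1]
  have y1 : (γ 1).2.1 = u2 := by rw [g1]
  have t1 : (γ 1).2.2 = σ := by rw [g1]
  set r := Real.sqrt (u1 ^ 2 + u2 ^ 2) with hr
  have hr2 : r * r = u1 ^ 2 + u2 ^ 2 := Real.mul_self_sqrt (by positivity)
  have hr0 : 0 ≤ r := Real.sqrt_nonneg _
  have hrL : r ≤ L := by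
    have := hor.proj (by norm_num)
    rw [x0, y0, x1, y1, sub_zero, sub_zero, ← hLe] at this
    exact this
  refine ⟨hrL, ?_⟩
  obtain ⟨hx, hy, ht, hd⟩ := hor.derivs
  -- intermediate bounds
  have key : ∀ s ∈ Set.Icc (0:ℝ) 1, ∃ l1 l2 : ℝ, l1 + l2 = L ∧ 0 ≤ l1 ∧ 0 ≤ l2 ∧
      Real.sqrt ((γ s).1 ^ 2 + (γ s).2.1 ^ 2) ≤ l1 ∧
      Real.sqrt ((u1 - (γ s).1) ^ 2 + (u2 - (γ s).2.1) ^ 2) ≤ l2 := by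
    intro s hs
    have h1 := hor.mono le_rfl hs.1 hs.2
    have h2 := hor.mono hs.1 hs.2 le_rfl
    refine ⟨∫ x in (0:ℝ)..s, vv a b x, ∫ x in s..1, vv a b x, ?_, ?_, ?_, ?_, ?_⟩
    · rw [hLe, intervalIntegral.integral_add_adjacent_intervals h1.2.2 h2.2.2]
    · exact intervalIntegral.integral_nonneg hs.1 (fun s _ => vv_nonneg a b s)
    · exact intervalIntegral.integral_nonneg hs.2 (fun s _ => vv_nonneg a b s)
    · have := h1.proj hs.1
      rwa [x0, y0, sub_zero, sub_zero] at this
    · have := h2.proj hs.2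
      rwa [x1, y1] at this
  rcases eq_or_lt_of_le hr0 with h0 | h0
  · have := mvt (C := 2 * L) zero_le_one ht hor.2.2 (by
      filter_upwards [hd] with s hs hs'
      obtain ⟨h1, h2, h3⟩ := hs hs'
      refine ⟨_, h3, ?_⟩
      obtain ⟨l1, l2, e, p1, p2, e1, e2⟩ := key s hs'
      have h4 := cs (γ s).2.1 (-(γ s).1) (a s) (b s)
      rw [show (γ s).2.1 ^ 2 + (-(γ s).1) ^ 2 = (γ s).1 ^ 2 + (γ s).2.1 ^ 2 by ring] at h4
      rw [show 2 * (γ s).2.1 * a s - 2 * (γ s).1 * b s = 2 * ((γ s).2.1 * a s + -(γ s).1 * b s) by ring,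
        abs_mul, abs_two]
      have h5 : Real.sqrt ((γ s).1 ^ 2 + (γ s).2.1 ^ 2) * vv a b s ≤ L * vv a b s :=
        mul_le_mul_of_nonneg_right (by linarith) (vv_nonneg a b s)
      unfold vv at h5 ⊢
      linarith)
    rw [t0, t1, sub_zero, ← hLe] at this
    rw [← h0]
    have h6 : σ ^ 2 ≤ (2 * L * L) ^ 2 := by
      rw [← sq_abs σ]
      exact pow_le_pow_left₀ (abs_nonneg σ) this 2
    nlinarith [pow_nonneg hL 4]
  · set B := Real.sqrt (2 * L * (L - r)) with hB
    have hB2 : B * B = 2 * L * (L - r) := Real.mul_self_sqrt (by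
      apply mul_nonneg <;> linarith)
    have hB0 : 0 ≤ B := Real.sqrt_nonneg _
    have hp := (hy.const_mul u1).sub (hx.const_mul u2)
    have hq := (hx.const_mul u1).add (hy.const_mul u2)
    have hG := (ht.const_mul (r * r)).add ((hp.mul hq).const_mul 2)
    have := mvt (C := 4 * (r * B) * r) zero_le_one hG hor.2.2 (by
      filter_upwards [hd] with s hs hs'
      obtain ⟨h1, h2, h3⟩ := hs hs'
      refine ⟨_, (h3.const_mul (r * r)).add ((((h2.const_mul u1).sub (h1.const_mul u2)).mul
        ((h1.const_mul u1).add (h2.const_mul u2))).const_mul 2), ?_⟩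
      obtain ⟨l1, l2, e, p1, p2, e1, e2⟩ := key s hs'
      simp only [Pi.add_apply, Pi.sub_apply]
      generalize (γ s).1 = x at *
      generalize (γ s).2.1 = y at *
      have hv : vv a b s = Real.sqrt (a s ^ 2 + b s ^ 2) := rfl
      rw [hv]
      have h4 := cs u1 u2 (a s) (b s)
      rw [← hr] at h4
      generalize a s = a' at *
      generalize b s = b' at *
      rw [show r * r * (2 * y * a' - 2 * x * b') + 2 * ((u1 * b' - u2 * a') * (u1 * x + u2 * y) +
        (u1 * y - u2 * x) * (u1 * a' + u2 * b')) = 4 * (u1 * y - u2 * x) * (u1 * a' + u2 * b') by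
          rw [hr2]; ring]
      have h5 : |u1 * y - u2 * x| ≤ r * B := by
        exact dev u1 u2 x y l1 l2 L r B hr hr2 h0 hB0 hB2 hL hrL e p1 p2 e1 e2
      rw [abs_mul, abs_mul, abs_of_pos (show (0:ℝ) < 4 by norm_num), mul_assoc (4 * (r * B))]
      exact mul_le_mul (by linarith) h4 (abs_nonneg _) (by positivity))
    simp only [Pi.add_apply, Pi.sub_apply, Pi.mul_apply, x0, y0, t0, x1, y1, t1, ← hLe] at this
    rw [show r * r * σ + 2 * ((u1 * u2 - u2 * u1) * (u1 * u1 + u2 * u2)) -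
      (r * r * 0 + 2 * ((u1 * 0 - u2 * 0) * (u1 * 0 + u2 * 0))) = (r * r) * σ by ring, abs_mul,
      abs_of_pos (by positivity)] at this
    have h7 : |σ| ≤ 4 * B * L := by
      have : (r * r) * |σ| ≤ (r * r) * (4 * B * L) := by linarith
      exact le_of_mul_le_mul_left this (by positivity)
    have h6 : σ ^ 2 ≤ (4 * B * L) ^ 2 := by
      rw [← sq_abs σ]
      exact pow_le_pow_left₀ (abs_nonneg σ) h7 2
    calc σ ^ 2 ≤ (4 * B * L) ^ 2 := h6
      _ = 16 * (B * B) * L ^ 2 := by ring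
      _ = _ := by rw [hB2]; ring

lemma dH_low {P : H} {L : ℝ} (h : dH HO P < L) :
    Real.sqrt (P.1 ^ 2 + P.2.1 ^ 2) ≤ L ∧
      P.2.2 ^ 2 ≤ 32 * L ^ 3 * (L - Real.sqrt (P.1 ^ 2 + P.2.1 ^ 2)) := by
  obtain ⟨L', h1, h2⟩ := dH_lt h
  have h0 := h2.nonneg
  obtain ⟨h3, h4⟩ := IsHC.low (u1 := P.1) (u2 := P.2.1) (σ := P.2.2) h2
  refine ⟨by linarith, h4.trans ?_⟩
  have : L' ^ 3 ≤ L ^ 3 := pow_le_pow_left₀ h0 h1.le 3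
  exact mul_le_mul (by linarith) (by linarith) (by linarith)
    (mul_nonneg (by norm_num) (pow_nonneg (by linarith) 3))

lemma dH_low' {P : H} {L : ℝ} (h : dH HO P ≤ L) :
    Real.sqrt (P.1 ^ 2 + P.2.1 ^ 2) ≤ L := by
  apply le_of_forall_pos_le_add
  intro e he
  exact (dH_low (lt_of_le_of_lt h (by linarith))).1

lemma dH_self (P : H) : dH P P = 0 := by
  apply le_antisymm _ (dH_nonneg _ _)
  have := (IsHC.step P 0 0).dH_le
  rw [show Hmul P (0, 0, 0) = P by ext <;> simp [Hmul]] at this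
  simpa using this

lemma Hor.dH_le {γ : ℝ → H} {a b : ℝ → ℝ} {α β : ℝ} (h : Hor γ a b α β) (hab : α ≤ β) :
    dH (γ α) (γ β) ≤ ∫ s in α..β, vv a b s := by
  rcases eq_or_lt_of_le hab with h1 | h1
  · subst h1
    simp [dH_self]
  · exact (h.isHC h1).dH_le

lemma hMidpt {P Q : H} {L : ℝ} (h : dH P Q < L) : ∃ M, dH P M ≤ L / 2 ∧ dH M Q ≤ L / 2 := by
  obtain ⟨L', h1, h2⟩ := dH_lt h
  have h0 := h2.nonneg
  obtain ⟨γ, a, b, hor, rfl, rfl, hL⟩ := h2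
  have hc : ContinuousOn (fun c => ∫ s in (0:ℝ)..c, vv a b s) (Set.Icc 0 1) := by
    have := intervalIntegral.continuousOn_primitive_interval (a := (0:ℝ)) (b := 1) (f := vv a b)
      (μ := volume) (by
        have := hor.2.2
        rw [intervalIntegrable_iff_integrableOn_Icc_of_le (by norm_num)] at this
        rwa [Set.uIcc_of_le (by norm_num)])
    rwa [Set.uIcc_of_le (by norm_num)] at this
  obtain ⟨c, hc1, hc2⟩ := intermediate_value_Icc (by norm_num : (0:ℝ) ≤ 1) hc
    (show L' / 2 ∈ _ by
      simp only [intervalIntegral.integral_same, ← hL]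
      constructor <;> linarith)
  simp only at hc2
  have g1 := hor.mono le_rfl hc1.1 hc1.2
  have g2 := hor.mono hc1.1 hc1.2 le_rfl
  refine ⟨γ c, ?_, ?_⟩
  · have := g1.dH_le hc1.1
    linarith
  · have := g2.dH_le hc1.2
    have e := intervalIntegral.integral_add_adjacent_intervals g1.2.2 g2.2.2
    linarith

lemma dH_low3_aux {P : H} {L : ℝ} (h : dH HO P < L) : P.2.2 ^ 2 ≤ 32 * L ^ 4 := by
  have h0 := dH_nonneg HO P
  have h1 := (dH_low h).2
  have h2 : 0 ≤ 32 * L ^ 3 := mul_nonneg (by norm_num) (pow_nonneg (by linarith) 3)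
  nlinarith [Real.sqrt_nonneg (P.1 ^ 2 + P.2.1 ^ 2)]

lemma dH_low3 {P : H} {L : ℝ} (h : dH HO P ≤ L) :
    |P.1| ≤ L ∧ |P.2.1| ≤ L ∧ |P.2.2| ≤ 6 * L ^ 2 := by
  have h0 := (dH_nonneg HO P).trans h
  have h1 := dH_low' h
  refine ⟨?_, ?_, ?_⟩
  · exact le_trans (Real.abs_le_sqrt (by nlinarith [sq_nonneg P.2.1])) h1
  · exact le_trans (Real.abs_le_sqrt (by nlinarith [sq_nonneg P.1])) h1
  · rcases eq_or_lt_of_le h0 with h2 | h2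
    · subst h2
      have : P.2.2 = 0 := by
        by_contra hne
        have hp : 0 < P.2.2 ^ 2 := by positivity
        obtain ⟨e, he0, he1, he2⟩ : ∃ e : ℝ, 0 < e ∧ e ≤ 1 ∧ 64 * e ≤ P.2.2 ^ 2 :=
          ⟨min 1 (P.2.2 ^ 2 / 64), by positivity, min_le_left _ _, by
            have := min_le_right 1 (P.2.2 ^ 2 / 64)
            linarith⟩
        have h3 := dH_low3_aux (lt_of_le_of_lt h he0)
        have h4 : e ^ 4 ≤ e := by
          have := pow_le_one₀ (n := 3) he0.le he1
          nlinarith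
        linarith
      simp [this]
    · have h3 := dH_low3_aux (lt_of_le_of_lt h (show L < 1.02 * L by linarith))
      apply abs_le_of_sq_le_sq _ (by positivity)
      have : 0 < L ^ 4 := by positivity
      ring_nf at h3 ⊢
      linarith

lemma dvert_pos {t : ℝ} (ht : t ≠ 0) : 0 < dH HO (0, 0, t) := by
  rcases eq_or_lt_of_le (dH_nonneg HO (0, 0, t)) with h | h
  · have := (dH_low3 (le_of_eq h.symm)).2.2
    simp at this
    exact absurd this ht
  · exact h

lemma dvert_scale {t s : ℝ} (ht : 0 < t) (hs : t / 2 ≤ s) :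
    dH HO (0, 0, t) ≤ 1.42 * dH HO (0, 0, s) := by
  have hs0 : 0 < s := by linarith
  have h := dH_map HO (0, 0, s) (Real.sqrt (t / s)) HO
  have e1 : Phi (Real.sqrt (t / s)) HO HO = HO := by ext <;> simp [Phi, Hmul, HO]
  have e2 : Phi (Real.sqrt (t / s)) HO (0, 0, s) = (0, 0, t) := by
    ext
    · simp [Phi, Hmul, HO]
    · simp [Phi, Hmul, HO]
    · simp only [Phi, Hmul, HO]
      rw [Real.sq_sqrt (by positivity)]
      field_simp
      ring
  rw [e1, e2, abs_of_nonneg (Real.sqrt_nonneg _)] at h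
  refine h.trans (mul_le_mul_of_nonneg_right ?_ (dH_nonneg _ _))
  apply Real.sqrt_le_iff.2 ⟨by norm_num, ?_⟩
  rw [div_le_iff₀ hs0]
  linarith

lemma wlow {t L : ℝ} {M : H} (ht : 0 < t) (h1 : dH HO M ≤ L / 2) (h2 : dH M (0, 0, t) ≤ L / 2) :
    dH HO (0, 0, t) ≤ 1.42 * (L / 2 + Real.sqrt (M.1 ^ 2 + M.2.1 ^ 2)) := by
  rcases le_total (t / 2) M.2.2 with h | h
  · refine (dvert_scale ht h).trans ?_
    have h3 := dH_tri HO M (0, 0, M.2.2)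
    have h4 := (IsHC.step M (-M.1) (-M.2.1)).dH_le
    rw [show Hmul M (-M.1, -M.2.1, 0) = (0, 0, M.2.2) by ext <;> simp [Hmul, mul_comm],
      neg_sq, neg_sq] at h4
    linarith
  · refine (dvert_scale ht (s := t - M.2.2) (by linarith)).trans ?_
    have h3 := dH_tri (0, 0, M.2.2) M (0, 0, t)
    have h4 := (IsHC.step (0, 0, M.2.2) (M.1) (M.2.1)).dH_le
    rw [show Hmul (0, 0, M.2.2) (M.1, M.2.1, 0) = M by ext <;> simp [Hmul]] at h4
    rw [dH_O (0, 0, M.2.2) (0, 0, t), show Hmul (Hinv (0, 0, M.2.2)) (0, 0, t) = (0, 0, t - M.2.2) by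
      ext <;> simp [Hmul, Hinv]; ring] at h3
    linarith

lemma near1 {D z1 z2 l : ℝ} {N : H} (hD : 0 < D) (hl : l = (1 + 1e-8) * D / 2)
    (hz : (1 - 1e-8) * D ≤ Real.sqrt (z1 ^ 2 + z2 ^ 2)) (h1 : dH HO N < l)
    (h2 : dH N (z1, z2, 0) ≤ l) :
    (N.1 - z1 / 2) ^ 2 + (N.2.1 - z2 / 2) ^ 2 ≤ 1e-8 * D ^ 2 ∧ |N.2.2| ≤ 4e-4 * D ^ 2 ∧
    Real.sqrt (N.1 ^ 2 + N.2.1 ^ 2) ≤ 0.51 * D := by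
  obtain ⟨a1, a2⟩ := dH_low h1
  rw [dH_O] at h2
  have b1 := dH_low' h2
  have e : ((Hmul (Hinv N) (z1, z2, 0)).1) ^ 2 + ((Hmul (Hinv N) (z1, z2, 0)).2.1) ^ 2
    = (z1 - N.1) ^ 2 + (z2 - N.2.1) ^ 2 := by simp [Hmul, Hinv]; ring
  rw [e] at b1
  clear e
  generalize N.1 = x at *
  generalize N.2.1 = y at *
  generalize N.2.2 = σ at *
  have c1 := cs z1 z2 x y
  have c2 := cs z1 z2 (z1 - x) (z2 - y)
  have r2 := Real.mul_self_sqrt (show 0 ≤ z1 ^ 2 + z2 ^ 2 by positivity)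
  have u2 := Real.mul_self_sqrt (show 0 ≤ x ^ 2 + y ^ 2 by positivity)
  have v2 := Real.mul_self_sqrt (show 0 ≤ (z1 - x) ^ 2 + (z2 - y) ^ 2 by positivity)
  have u0 := Real.sqrt_nonneg (x ^ 2 + y ^ 2)
  have v0 := Real.sqrt_nonneg ((z1 - x) ^ 2 + (z2 - y) ^ 2)
  set r := Real.sqrt (z1 ^ 2 + z2 ^ 2)
  set u := Real.sqrt (x ^ 2 + y ^ 2)
  set v := Real.sqrt ((z1 - x) ^ 2 + (z2 - y) ^ 2)
  have hr : 0 < r := by linarith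
  have l0 : 0 < l := by linarith
  have tri : r ≤ u + v := by
    have : r * r ≤ r * (u + v) := by
      have := (abs_le.1 c1).2
      have := (abs_le.1 c2).2
      linarith
    exact le_of_mul_le_mul_left this hr
  have hu2 : u * u ≤ l * l := mul_le_mul a1 a1 u0 l0.le
  have hv2 : v * v ≤ l * l := mul_le_mul b1 b1 v0 l0.le
  have hr2 : ((1 - 1e-8) * D) * ((1 - 1e-8) * D) ≤ r * r :=
    mul_le_mul hz hz (by linarith) hr.le
  refine ⟨?_, ?_, by linarith⟩
  · have : (x - z1 / 2) ^ 2 + (y - z2 / 2) ^ 2 = (u * u + v * v) / 2 - r * r / 4 := by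
      rw [u2, v2, r2]; ring
    rw [this]
    rw [hl] at hu2 hv2
    ring_nf at hu2 hv2 hr2 ⊢
    linarith
  · apply abs_le_of_sq_le_sq _ (by positivity)
    have h3 : l - u ≤ 2e-8 * D := by linarith
    have h4 : l ^ 3 ≤ (0.51 * D) ^ 3 := pow_le_pow_left₀ l0.le (by linarith) 3
    have h5 : 32 * l ^ 3 * (l - u) ≤ 32 * (0.51 * D) ^ 3 * (2e-8 * D) :=
      mul_le_mul (by linarith) h3 (by linarith) (by positivity)
    have : 0 < D ^ 4 := by positivity
    ring_nf at h5 a2 ⊢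
    linarith

lemma near2 {D z1 z2 l : ℝ} {N N' : H} (hD : 0 < D) (hl : l = (1 + 1e-8) * D / 2)
    (hz : (1 - 1e-8) * D ≤ Real.sqrt (z1 ^ 2 + z2 ^ 2)) (h1 : dH HO N < l)
    (h2 : dH N (z1, z2, 0) ≤ l) (h1' : dH HO N' < l)
    (h2' : dH N' (z1, z2, 0) ≤ l) : dH N N' ≤ 0.09 * D := by
  obtain ⟨a1, a2, a3⟩ := near1 hD hl hz h1 h2
  obtain ⟨b1, b2, b3⟩ := near1 hD hl hz h1' h2'
  rw [dH_O]
  refine (dH_up _).trans ?_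
  have e1 : (Hmul (Hinv N) N').1 = N'.1 - N.1 := by simp [Hmul, Hinv]; ring
  have e2 : (Hmul (Hinv N) N').2.1 = N'.2.1 - N.2.1 := by simp [Hmul, Hinv]; ring
  have e3 : (Hmul (Hinv N) N').2.2 = N'.2.2 - N.2.2 +
      2 * ((-N.2.1) * (N'.1 - N.1) + N.1 * (N'.2.1 - N.2.1)) := by simp [Hmul, Hinv]; ring
  rw [e1, e2, e3]
  clear e1 e2 e3
  have c := cs (-N.2.1) N.1 (N'.1 - N.1) (N'.2.1 - N.2.1)
  rw [show (-N.2.1) ^ 2 + N.1 ^ 2 = N.1 ^ 2 + N.2.1 ^ 2 by ring] at c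
  have hd : Real.sqrt ((N'.1 - N.1) ^ 2 + (N'.2.1 - N.2.1) ^ 2) ≤ 2e-4 * D := by
    apply Real.sqrt_le_iff.2 ⟨by positivity, ?_⟩
    nlinarith [sq_nonneg ((N.1 - z1 / 2) + (N'.1 - z1 / 2)),
      sq_nonneg ((N.2.1 - z2 / 2) + (N'.2.1 - z2 / 2))]
  have c' := c.trans (mul_le_mul a3 hd (Real.sqrt_nonneg _) (by positivity))
  have hs : Real.sqrt |N'.2.2 - N.2.2 +
      2 * ((-N.2.1) * (N'.1 - N.1) + N.1 * (N'.2.1 - N.2.1))| ≤ 0.04 * D := by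
    apply Real.sqrt_le_iff.2 ⟨by positivity, ?_⟩
    rw [abs_le] at *
    have : 0 < D ^ 2 := by positivity
    constructor <;> nlinarith
  linarith

lemma nonvanish {ε : ℝ} (h0 : 0 ≤ ε) (hε : ε ≤ 1e-9) {f : H → H} (hf : IsBiLip ε f) (P₀ : H)
    {t : ℝ} (ht : 0 < t) : (Hmul (Hinv (f P₀)) (f (Hmul P₀ (0, 0, t)))).2.2 ≠ 0 := by
  intro hz
  let g : H → H := fun P => Hmul (Hinv (f P₀)) (f (Hmul P₀ P))
  have gO : g HO = HO := by
    simp only [g]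
    rw [show Hmul P₀ HO = P₀ by ext <;> simp [Hmul, HO], Hinv_mul]
  have g1 : ∀ P Q, dH (g P) (g Q) ≤ (1 + 1e-9) * dH P Q := by
    intro P Q
    simp only [g]
    rw [dH_left]
    refine (hf _ _).2.trans ?_
    rw [dH_left]
    exact mul_le_mul_of_nonneg_right (by linarith) (dH_nonneg _ _)
  have g2 : ∀ P Q, dH P Q ≤ (1 + 1e-9) * dH (g P) (g Q) := by
    intro P Q
    simp only [g]
    rw [dH_left]
    have h := (hf (Hmul P₀ P) (Hmul P₀ Q)).1
    rw [dH_left, inv_mul_le_iff₀ (by linarith)] at h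
    exact h.trans (mul_le_mul_of_nonneg_right (by linarith) (dH_nonneg _ _))
  set D := dH HO (0, 0, t) with hDdef
  have hD : 0 < D := dvert_pos ht.ne'
  obtain ⟨M, m1, m2⟩ := hMidpt (show dH HO (0, 0, t) < (1 + 1e-9) * D by linarith)
  let M' : H := (-M.1, -M.2.1, M.2.2)
  have m1' : dH HO M' ≤ (1 + 1e-9) * D / 2 := by
    have := dH_map HO M (-1) HO
    rw [show Phi (-1) HO HO = HO by ext <;> simp [Phi, Hmul, HO],
      show Phi (-1) HO M = M' by ext <;> simp [Phi, Hmul, HO, M']] at this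
    simp at this
    linarith
  have m2' : dH M' (0, 0, t) ≤ (1 + 1e-9) * D / 2 := by
    have := dH_map M (0, 0, t) (-1) HO
    rw [show Phi (-1) HO (0, 0, t) = (0, 0, t) by ext <;> simp [Phi, Hmul, HO],
      show Phi (-1) HO M = M' by ext <;> simp [Phi, Hmul, HO, M']] at this
    simp at this
    linarith
  have gZ : g (0, 0, t) = ((g (0, 0, t)).1, (g (0, 0, t)).2.1, 0) := by
    ext <;> simp
    exact hz
  have hr : (1 - 1e-8) * D ≤ Real.sqrt ((g (0, 0, t)).1 ^ 2 + (g (0, 0, t)).2.1 ^ 2) := by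
    have q1 := g2 HO (0, 0, t)
    have q2 := dH_up (g (0, 0, t))
    rw [show (g (0, 0, t)).2.2 = 0 from hz] at q2
    simp only [abs_zero, Real.sqrt_zero, mul_zero, add_zero] at q2
    rw [gO] at q1
    linarith
  have k1 : ∀ M, dH HO M ≤ (1 + 1e-9) * D / 2 → dH HO (g M) < (1 + 1e-8) * D / 2 := by
    intro M h
    have := g1 HO M
    rw [gO] at this
    linarith
  have k2 : ∀ M, dH M (0, 0, t) ≤ (1 + 1e-9) * D / 2 →
      dH (g M) ((g (0, 0, t)).1, (g (0, 0, t)).2.1, 0) ≤ (1 + 1e-8) * D / 2 := by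
    intro M h
    have := g1 M (0, 0, t)
    rw [← gZ]
    linarith
  have hN := near2 hD rfl hr (k1 M m1) (k2 M m2) (k1 M' m1') (k2 M' m2')
  have q1 := g2 M M'
  have q2 := wlow ht m1 m2
  rw [dH_O M M'] at q1
  have q3 := dH_low' q1
  have e : (Hmul (Hinv M) M').1 ^ 2 + (Hmul (Hinv M) M').2.1 ^ 2 = 2 ^ 2 * (M.1 ^ 2 + M.2.1 ^ 2) := by
    simp [Hmul, Hinv, M']; ring
  rw [e, Real.sqrt_mul (by norm_num), Real.sqrt_sq (by norm_num)] at q3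
  rw [← hDdef] at q2
  linarith

lemma bilip_cont {ε : ℝ} (h0 : 0 ≤ ε) {f : H → H} (hf : IsBiLip ε f) : Continuous f := by
  rw [continuous_iff_continuousAt]
  intro P
  let h : H → ℝ := fun Q => (1 + ε) * (Real.sqrt ((Hmul (Hinv P) Q).1 ^ 2 + (Hmul (Hinv P) Q).2.1 ^ 2)
    + 2 * Real.sqrt |(Hmul (Hinv P) Q).2.2|)
  have hc : Continuous h := by
    simp only [h, Hmul, Hinv]
    fun_prop
  have hP : h P = 0 := by
    simp only [h]
    rw [Hinv_mul]
    simp [HO]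
  have hh : Filter.Tendsto h (nhds P) (nhds 0) := by
    have := hc.tendsto P
    rwa [hP] at this
  let E : H → H := fun Q => Hmul (Hinv (f P)) (f Q)
  have hE : ∀ Q, dH HO (E Q) ≤ h Q := by
    intro Q
    simp only [E]
    rw [← dH_O]
    refine (hf P Q).2.trans ?_
    rw [dH_O P Q]
    exact mul_le_mul_of_nonneg_left (dH_up _) (by linarith)
  have hh2 : Filter.Tendsto (fun Q => 6 * h Q ^ 2) (nhds P) (nhds 0) := by
    have := (hh.pow 2).const_mul 6
    simpa using this
  have t1 : Filter.Tendsto (fun Q => (E Q).1) (nhds P) (nhds 0) :=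
    squeeze_zero_norm (fun Q => (dH_low3 (hE Q)).1) hh
  have t2 : Filter.Tendsto (fun Q => (E Q).2.1) (nhds P) (nhds 0) :=
    squeeze_zero_norm (fun Q => (dH_low3 (hE Q)).2.1) hh
  have t3 : Filter.Tendsto (fun Q => (E Q).2.2) (nhds P) (nhds 0) :=
    squeeze_zero_norm (fun Q => (dH_low3 (hE Q)).2.2) hh2
  have tE : Filter.Tendsto E (nhds P) (nhds HO) := t1.prodMk_nhds (t2.prodMk_nhds t3)
  have hm : Continuous (Hmul (f P)) := by
    unfold Hmul
    fun_prop
  have := (hm.tendsto HO).comp tE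
  rw [show Hmul (f P) HO = f P by ext <;> simp [Hmul, HO]] at this
  refine this.congr (fun Q => ?_)
  simp only [Function.comp, E]
  rw [Hmul_inv_cancel]

lemma tau_sign_one {ε : ℝ} (h0 : 0 ≤ ε) (hε : ε ≤ 1e-9) {f : H → H} (hf : IsBiLip ε f) {R δ : ℝ}
    (hR : 0 < R) (hδ : δ ≤ 1 / 200) (a b c d : ℝ) (hab : a ^ 2 + c ^ 2 = 1) (hcd : b ^ 2 + d ^ 2 = 1)
    (hdet : a * d - b * c = 1)
    (H1 : ∀ x y : ℝ, Real.sqrt (x ^ 2 + y ^ 2) ≤ R →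
      dH (f (x, y, 0)) (a * x + b * y, c * x + d * y, 0) ≤ δ * R) :
    0 < (Hmul (Hinv (f (R / 2, 0, 0))) (f (Hmul (R / 2, 0, 0) (0, 0, R ^ 2 / 100)))).2.2 := by
  have s1 := H1 (R / 2) 0 (by
    apply Real.sqrt_le_iff.2 ⟨hR.le, by nlinarith⟩)
  have s2 := H1 (R / 2) (R / 100) (by
    apply Real.sqrt_le_iff.2 ⟨hR.le, by nlinarith⟩)
  set G := f (R / 2, 0, 0)
  set F := f (Hmul (R / 2, 0, 0) (0, 0, R ^ 2 / 100))
  have s3 : dH F (f (R / 2, R / 100, 0)) ≤ 1.01 * (R / 100) := by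
    refine (hf _ _).2.trans ?_
    have h1 := (IsHC.step (Hmul (R / 2, 0, 0) (0, 0, R ^ 2 / 100)) 0 (R / 100)).dH_le
    rw [show Hmul (Hmul (R / 2, 0, 0) (0, 0, R ^ 2 / 100)) (0, R / 100, 0) = (R / 2, R / 100, 0) by
      ext <;> simp [Hmul]; ring, show (0:ℝ) ^ 2 + (R / 100) ^ 2 = (R / 100) ^ 2 by ring,
      Real.sqrt_sq (by positivity)] at h1
    exact mul_le_mul (by linarith) h1 (dH_nonneg _ _) (by norm_num)
  have s4 := dH_tri F (f (R / 2, R / 100, 0)) (a * (R / 2) + b * (R / 100), c * (R / 2) + d * (R / 100), 0)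
  have hδR : δ * R ≤ R / 200 := by nlinarith
  have s5 : dH F (a * (R / 2) + b * (R / 100), c * (R / 2) + d * (R / 100), 0) ≤ R / 50 := by linarith
  have s6 : dH G (a * (R / 2) + b * 0, c * (R / 2) + d * 0, 0) ≤ R / 200 := by linarith
  rw [dH_O] at s5 s6
  obtain ⟨e1, e2, e3⟩ := dH_low3 s5
  obtain ⟨k1, k2, k3⟩ := dH_low3 s6
  have hb : |b| ≤ 1 := by
    apply abs_le_of_sq_le_sq _ (by norm_num); nlinarith
  have hd : |d| ≤ 1 := by
    apply abs_le_of_sq_le_sq _ (by norm_num); nlinarith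
  set E := Hmul (Hinv F) (a * (R / 2) + b * (R / 100), c * (R / 2) + d * (R / 100), 0) with hE
  set K := Hmul (Hinv G) (a * (R / 2) + b * 0, c * (R / 2) + d * 0, 0) with hK
  have key : (Hmul (Hinv G) F).2.2 = R ^ 2 / 100 * (a * d - b * c) + K.2.2 - E.2.2
      + 2 * (K.2.1 * (b * (R / 100)) - K.1 * (d * (R / 100)) - K.2.1 * E.1 + K.1 * E.2.1
        - (d * (R / 100)) * E.1 + (b * (R / 100)) * E.2.1) := by
    simp only [hE, hK, Hmul, Hinv]
    ring
  rw [key, hdet]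
  have hbR : |b * (R / 100)| ≤ R / 100 := by
    rw [abs_mul, abs_of_pos (show 0 < R / 100 by positivity)]; nlinarith
  have hdR : |d * (R / 100)| ≤ R / 100 := by
    rw [abs_mul, abs_of_pos (show 0 < R / 100 by positivity)]; nlinarith
  have pr : ∀ {x y X Y : ℝ}, |x| ≤ X → |y| ≤ Y → |x * y| ≤ X * Y := by
    intro x y X Y hx hy
    rw [abs_mul]
    exact mul_le_mul hx hy (abs_nonneg _) ((abs_nonneg _).trans hx)
  have p1 := abs_le.1 (pr k2 hbR)
  have p2 := abs_le.1 (pr k1 hdR)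
  have p3 := abs_le.1 (pr k2 e1)
  have p4 := abs_le.1 (pr k1 e2)
  have p5 := abs_le.1 (pr hdR e1)
  have p6 := abs_le.1 (pr hbR e2)
  have p7 := abs_le.1 e3
  have p8 := abs_le.1 k3
  have : 0 < R ^ 2 := by positivity
  linarith [p1.1, p2.2, p3.2, p4.1, p5.2, p6.1, p7.2, p8.1]

lemma tau_sign_pos {ε : ℝ} (h0 : 0 ≤ ε) (hε : ε ≤ 1e-9) {f : H → H} (hf : IsBiLip ε f) {P₀ : H}
    {t₀ : ℝ} (ht₀ : 0 < t₀) (h : 0 < (Hmul (Hinv (f P₀)) (f (Hmul P₀ (0, 0, t₀)))).2.2)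
    (P : H) {t : ℝ} (ht : 0 < t) : 0 < (Hmul (Hinv (f P)) (f (Hmul P (0, 0, t)))).2.2 := by
  have hc := bilip_cont h0 hf
  let p : ℝ → H := fun r => (P.1 + r * (P₀.1 - P.1), P.2.1 + r * (P₀.2.1 - P.2.1),
    P.2.2 + r * (P₀.2.2 - P.2.2))
  let τ : ℝ → ℝ := fun r => t + r * (t₀ - t)
  let φ : ℝ → ℝ := fun r => (Hmul (Hinv (f (p r))) (f (Hmul (p r) (0, 0, τ r)))).2.2
  have hφ : Continuous φ := by
    have hp : Continuous p := by fun_prop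
    have hτ : Continuous τ := by fun_prop
    have h1 : Continuous (fun r => f (p r)) := hc.comp hp
    have h2 : Continuous (fun r => f (Hmul (p r) (0, 0, τ r))) := by
      apply hc.comp
      unfold Hmul
      fun_prop
    simp only [φ, Hmul, Hinv] at h2 ⊢
    fun_prop
  have e0 : φ 0 = (Hmul (Hinv (f P)) (f (Hmul P (0, 0, t)))).2.2 := by
    simp [φ, p, τ]
  have e1 : φ 1 = (Hmul (Hinv (f P₀)) (f (Hmul P₀ (0, 0, t₀)))).2.2 := by
    simp [φ, p, τ]
  rw [← e0]
  rw [← e1] at h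
  by_contra hn
  push Not at hn
  obtain ⟨r, hr, hr2⟩ := intermediate_value_Icc (zero_le_one) hφ.continuousOn
    (show (0:ℝ) ∈ Set.Icc (φ 0) (φ 1) from ⟨hn, h.le⟩)
  refine nonvanish h0 hε hf (p r) (t := τ r) ?_ hr2
  simp only [τ]
  rcases eq_or_lt_of_le hr.1 with h2 | h2
  · rw [← h2]; linarith
  · nlinarith [hr.2, mul_pos h2 ht₀, mul_nonneg (sub_nonneg.2 hr.2) ht.le]

/-- Proposition: sign of `τ` on the `t`-axis.
There are `ε₀ > 0` and `C₀ > 0` such that: if `f = (ζ; τ)` is `(1+ε)`-biLipschitz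
with `ε ≤ ε₀`, `f(O) = O`, and for some `R > 0` and some `A ∈ O(2)` with
`det A = +1` one has `d(f(z;0), (Az;0)) ≤ C₀ ε^{1/16} R` for all `|z| ≤ R`, then
`τ(0,0,t)/t > 0` for all `t ≠ 0`. -/
theorem statement18 :
    ∃ ε₀ > (0:ℝ), ∃ C₀ > (0:ℝ),
      ∀ ε : ℝ, 0 ≤ ε → ε ≤ ε₀ →
      ∀ f : H → H, IsBiLip ε f → f HO = HO →
      ∀ R : ℝ, 0 < R →
      ∀ A : Matrix (Fin 2) (Fin 2) ℝ, A.transpose * A = 1 → A.det = 1 →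
        (∀ x y : ℝ, Real.sqrt (x ^ 2 + y ^ 2) ≤ R →
          dH (f (x, y, 0)) (A 0 0 * x + A 0 1 * y, A 1 0 * x + A 1 1 * y, 0)
            ≤ C₀ * ε ^ ((1:ℝ)/16) * R) →
        ∀ t : ℝ, t ≠ 0 → 0 < (f (0, 0, t)).2.2 / t := by
  refine ⟨1e-9, by norm_num, 1 / 200, by norm_num, ?_⟩
  intro ε h0 hε f hf hO R hR A hA hdet H1 t ht
  have hδ : 1 / 200 * ε ^ ((1:ℝ) / 16) ≤ 1 / 200 := by
    have := Real.rpow_le_one h0 (by linarith) (show (0:ℝ) ≤ 1 / 16 by norm_num)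
    linarith
  have hab : A 0 0 ^ 2 + A 1 0 ^ 2 = 1 := by
    have := congrFun (congrFun hA 0) 0
    simp [Matrix.mul_apply, Fin.sum_univ_two] at this
    linarith
  have hcd : A 0 1 ^ 2 + A 1 1 ^ 2 = 1 := by
    have := congrFun (congrFun hA 1) 1
    simp [Matrix.mul_apply, Fin.sum_univ_two] at this
    linarith
  rw [Matrix.det_fin_two] at hdet
  have s1 := tau_sign_one h0 hε hf hR hδ (A 0 0) (A 0 1) (A 1 0) (A 1 1) hab hcd hdet H1
  have s2 := fun P {t : ℝ} (ht : 0 < t) => tau_sign_pos h0 hε hf (by positivity) s1 P ht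
  rcases lt_or_gt_of_ne ht with h | h
  · have s3 := s2 (0, 0, t) (t := -t) (by linarith)
    rw [show Hmul (0, 0, t) (0, 0, -t) = HO by ext <;> simp [Hmul, HO], hO] at s3
    simp [Hmul, Hinv, HO] at s3
    exact div_pos_of_neg_of_neg s3 h
  · have s3 := s2 HO h
    rw [show Hmul HO (0, 0, t) = (0, 0, t) by ext <;> simp [Hmul, HO], hO] at s3
    simp [Hmul, Hinv, HO] at s3
    exact div_pos s3 h
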